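/- Let N be any quantum channel on 2×2 matrices. Then the Clifford-twirled channel Ñ(ρ) = (1/|C|) Σ_{c∈C} c† N(c ρ c†) c is a depolarizing channel with the same entanglement fidelity as N: Ñ = N_p where p = 1 − ⟨φ⁺| (I⊗N)(|φ⁺⟩⟨φ⁺|) |φ⁺⟩, and ⟨φ⁺| (I⊗Ñ)(|φ⁺⟩⟨φ⁺|) |φ⁺⟩ = ⟨φ⁺| (I⊗N)(|φ⁺⟩⟨φ⁺|) |φ⁺⟩. -/

import Mathlib

open scoped Matrix Kronecker ComplexOrder

/-- A finite family of Kraus operators from input space `A` to output space `B`. -/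
structure KrausFamily (A B : Type) [Fintype A] [DecidableEq A] [Fintype B] [DecidableEq B] :
    Type 1 where
  ι : Type
  [fι : Fintype ι]
  [dι : DecidableEq ι]
  K : ι → Matrix B A ℂ

attribute [instance] KrausFamily.fι KrausFamily.dι

variable {A B : Type} [Fintype A] [DecidableEq A] [Fintype B] [DecidableEq B]

/-- The trace-preservation condition `Σ Kᵢ† Kᵢ = 1` making a Kraus family a quantum channel. -/
def KrausFamily.IsChannel (N : KrausFamily A B) : Prop :=
  ∑ i, (N.K i)ᴴ * N.K i = 1

/-- The action of a channel: `N(ρ) = Σ Kᵢ ρ Kᵢ†`. -/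
noncomputable def KrausFamily.apply (N : KrausFamily A B) (ρ : Matrix A A ℂ) : Matrix B B ℂ :=
  ∑ i, N.K i * ρ * (N.K i)ᴴ

/-- The complementary channel: `N̂(ρ)ᵢⱼ = Tr (Kᵢ ρ Kⱼ†)`. -/
noncomputable def KrausFamily.compl (N : KrausFamily A B) (ρ : Matrix A A ℂ) :
    Matrix N.ι N.ι ℂ :=
  Matrix.of fun i j => (N.K i * ρ * (N.K j)ᴴ).trace

/-- Von Neumann entropy, base 2: `S(ρ) = −Σ λⱼ log₂ λⱼ` over the eigenvalues of `ρ`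
(junk value `0` for non-Hermitian matrices). -/
noncomputable def vnEntropy {n : Type} [Fintype n] [DecidableEq n] (ρ : Matrix n n ℂ) : ℝ :=
  if h : ρ.IsHermitian then -∑ j, h.eigenvalues j * Real.logb 2 (h.eigenvalues j) else 0

/-- A density matrix: positive semidefinite with unit trace. -/
def IsDensity {n : Type} [Fintype n] (ρ : Matrix n n ℂ) : Prop :=
  ρ.PosSemidef ∧ ρ.trace = 1

/-- Coherent information of `N` at input `φ`: `I^c(N,φ) = S(N(φ)) − S(N̂(φ))`. -/
noncomputable def cohInfo (N : KrausFamily A B) (φ : Matrix A A ℂ) : ℝ :=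
  vnEntropy (N.apply φ) - vnEntropy (N.compl φ)

/-- One-shot quantum capacity: `Q^{(1)}(N) = sup_φ I^c(N,φ)` over density matrices `φ`. -/
noncomputable def Q1 (N : KrausFamily A B) : ℝ :=
  sSup {x | ∃ φ : Matrix A A ℂ, IsDensity φ ∧ x = cohInfo N φ}

/-- The `n`-th tensor power of a Kraus family, whose Kraus operators are all `n`-fold
Kronecker products of Kraus operators of `N`. -/
noncomputable def KrausFamily.pow (N : KrausFamily A B) (n : ℕ) :
    KrausFamily (Fin n → A) (Fin n → B) where
  ι := Fin n → N.ι
  K f := Matrix.of fun b a => ∏ i, N.K (f i) (b i) (a i)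

/-- Quantum capacity: `Q(N) = sup_{n ≥ 1} (1/n) Q^{(1)}(N^{⊗n})`. -/
noncomputable def Qcap (N : KrausFamily A B) : ℝ :=
  sSup {x | ∃ n : ℕ, 0 < n ∧ x = (1 / (n : ℝ)) * Q1 (N.pow n)}

/-- `N` is degradable if some channel `D` maps its output to its complementary output. -/
def KrausFamily.IsDegradable (N : KrausFamily A B) : Prop :=
  ∃ D : KrausFamily B N.ι, D.IsChannel ∧ ∀ ρ : Matrix A A ℂ, D.apply (N.apply ρ) = N.compl ρ

/-- `N` is antidegradable if some channel `D` maps its complementary output to its output. -/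
def KrausFamily.IsAntidegradable (N : KrausFamily A B) : Prop :=
  ∃ D : KrausFamily N.ι B, D.IsChannel ∧ ∀ ρ : Matrix A A ℂ, D.apply (N.compl ρ) = N.apply ρ

/-- The Hadamard matrix `H = (1/√2)[[1,1],[1,−1]]`. -/
noncomputable def Had : Matrix (Fin 2) (Fin 2) ℂ :=
  ((Real.sqrt 2)⁻¹ : ℂ) • !![1, 1; 1, -1]

/-- The phase matrix `S = diag(1, i)`. -/
def Sgate : Matrix (Fin 2) (Fin 2) ℂ := !![1, 0; 0, Complex.I]

/-- `c : Fin 24 → M₂(ℂ)` is a family of representatives of the single-qubit Clifford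
group, the 24-element group (modulo global phase) generated by the Hadamard matrix and the
phase matrix: every `c i` is unitary and lies, up to a phase, in the group generated by
`H` and `S`, and every element of that group is a phase times exactly one `c i`. -/
def IsCliffordFamily (c : Fin 24 → Matrix (Fin 2) (Fin 2) ℂ) : Prop :=
  (∀ i, c i ∈ Matrix.unitaryGroup (Fin 2) ℂ) ∧
  (∀ i, ∃ z : ℂ, z • c i ∈ Submonoid.closure {Had, Sgate}) ∧
  (∀ u ∈ Submonoid.closure {Had, Sgate}, ∃! i, ∃ z : ℂ, u = z • c i)

/-- The Kraus operator `A₊` of the channel `N_(u,v)`. -/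
noncomputable def Aplus (u v : ℝ) : Matrix (Fin 2) (Fin 2) ℂ :=
  !![((Real.cos ((v - u) / 2) : ℝ) : ℂ), 0; 0, ((Real.cos ((v + u) / 2) : ℝ) : ℂ)]

/-- The Kraus operator `A₋` of the channel `N_(u,v)`. -/
noncomputable def Aminus (u v : ℝ) : Matrix (Fin 2) (Fin 2) ℂ :=
  !![0, ((Real.sin ((v + u) / 2) : ℝ) : ℂ); ((Real.sin ((v - u) / 2) : ℝ) : ℂ), 0]

/-- The two-parameter qubit channel `N_(u,v)` with Kraus operators `A₊`, `A₋`. -/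
noncomputable def Nuv (u v : ℝ) : KrausFamily (Fin 2) (Fin 2) where
  ι := Fin 2
  K := ![Aplus u v, Aminus u v]

/-- The flagged channel `T^dep_(u,v)(ρ) = (1/|C|) Σ_{c ∈ C} c† N_(u,v)(c ρ c†) c ⊗ |c⟩⟨c|`,
with Kraus operators `(1/√|C|) c† A_± c ⊗ |c⟩` for `c` running over a family of
representatives of the Clifford group. -/
noncomputable def Tdep (u v : ℝ) (c : Fin 24 → Matrix (Fin 2) (Fin 2) ℂ) :
    KrausFamily (Fin 2) (Fin 2 × Fin 24) where
  ι := Fin 24 × Fin 2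
  K x := Matrix.of fun bf a =>
    if bf.2 = x.1 then
      ((Real.sqrt 24)⁻¹ : ℂ) * ((c x.1)ᴴ * (![Aplus u v, Aminus u v] x.2) * c x.1) bf.1 a
    else 0

/-- Binary entropy `H(x) = −x log₂ x − (1−x) log₂ (1−x)`. -/
noncomputable def binEnt (x : ℝ) : ℝ :=
  -x * Real.logb 2 x - (1 - x) * Real.logb 2 (1 - x)

/-- Pauli `X`. -/
def PauliX : Matrix (Fin 2) (Fin 2) ℂ := !![0, 1; 1, 0]

/-- Pauli `Y`. -/
def PauliY : Matrix (Fin 2) (Fin 2) ℂ := !![0, -Complex.I; Complex.I, 0]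

/-- Pauli `Z`. -/
def PauliZ : Matrix (Fin 2) (Fin 2) ℂ := !![1, 0; 0, -1]

/-- Action of the depolarizing channel with (complex-valued) error probability `p`. -/
noncomputable def depolActionC (p : ℂ) (ρ : Matrix (Fin 2) (Fin 2) ℂ) :
    Matrix (Fin 2) (Fin 2) ℂ :=
  (1 - p) • ρ + (p / 3) • (PauliX * ρ * PauliX) +
    (p / 3) • (PauliY * ρ * PauliY) + (p / 3) • (PauliZ * ρ * PauliZ)

/-- The maximally entangled two-qubit state `|φ⁺⟩ = (1/√2)(|00⟩ + |11⟩)`. -/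
noncomputable def phiPlus : Fin 2 × Fin 2 → ℂ :=
  fun x => if x.1 = x.2 then ((Real.sqrt 2)⁻¹ : ℂ) else 0

/-- The channel `I ⊗ N`, with Kraus operators `I ⊗ Kᵢ`. -/
noncomputable def idTensor (N : KrausFamily (Fin 2) (Fin 2)) :
    KrausFamily (Fin 2 × Fin 2) (Fin 2 × Fin 2) where
  ι := N.ι
  K i := (1 : Matrix (Fin 2) (Fin 2) ℂ) ⊗ₖ N.K i

/-- The entanglement fidelity `⟨φ⁺| (I ⊗ N)(|φ⁺⟩⟨φ⁺|) |φ⁺⟩` of a qubit channel `N`. -/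
noncomputable def entFid (N : KrausFamily (Fin 2) (Fin 2)) : ℂ :=
  star phiPlus ⬝ᵥ ((idTensor N).apply (Matrix.vecMulVec phiPlus (star phiPlus)) *ᵥ phiPlus)

/-- The Clifford twirl `Ñ(ρ) = (1/|C|) Σ_{c ∈ C} c† N(c ρ c†) c` of a qubit channel. -/
noncomputable def twirl (N : KrausFamily (Fin 2) (Fin 2))
    (c : Fin 24 → Matrix (Fin 2) (Fin 2) ℂ) : KrausFamily (Fin 2) (Fin 2) where
  ι := Fin 24 × N.ι
  K x := ((Real.sqrt 24)⁻¹ : ℂ) • ((c x.1)ᴴ * N.K x.2 * c x.1)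

namespace KrausFamily

theorem isLinearMap_apply (N : KrausFamily A B) : IsLinearMap ℂ N.apply where
  map_add ρ τ := by simp [apply, Matrix.mul_add, Matrix.add_mul, Finset.sum_add_distrib]
  map_smul z ρ := by simp [apply, Finset.smul_sum]

theorem IsChannel.trace_apply {N : KrausFamily A B} (hN : N.IsChannel) (ρ : Matrix A A ℂ) :
    (N.apply ρ).trace = ρ.trace := by
  have h : (N.apply ρ).trace = ((∑ i, (N.K i)ᴴ * N.K i) * ρ).trace := by
    simp only [apply, Matrix.trace_sum, Finset.sum_mul]
    exact Finset.sum_congr rfl fun i _ => by rw [Matrix.trace_mul_comm, Matrix.mul_assoc]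
  rw [h, hN, one_mul]

end KrausFamily

section EntanglementFidelity

theorem entFid_eq_sum_trace (N : KrausFamily (Fin 2) (Fin 2)) :
    entFid N = 4⁻¹ * ∑ i, (N.K i).trace * star (N.K i).trace := by
  have h2 : ((Real.sqrt 2 : ℝ) : ℂ) ^ 2 = 2 := by
    rw [← Complex.ofReal_pow, Real.sq_sqrt zero_le_two]; norm_num
  have h4 : (((Real.sqrt 2 : ℝ) : ℂ)⁻¹) ^ 4 = 4⁻¹ := by
    rw [inv_pow, show 4 = 2 * 2 from rfl, pow_mul, h2]; norm_num
  simp only [entFid, KrausFamily.apply, Matrix.sum_mulVec, dotProduct_sum, Finset.mul_sum]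
  refine Finset.sum_congr rfl fun i _ => ?_
  rw [← h4]
  simp [idTensor, phiPlus, dotProduct, Matrix.mulVec, Matrix.mul_apply, Fintype.sum_prod_type,
    Matrix.vecMulVec_apply, Matrix.kroneckerMap_apply, Matrix.trace, Matrix.one_apply]
  ring

theorem entFid_eq_sum_apply_single (N : KrausFamily (Fin 2) (Fin 2)) :
    entFid N = 4⁻¹ * ∑ a, ∑ b, N.apply (Matrix.single a b 1) a b := by
  simp only [entFid_eq_sum_trace, KrausFamily.apply, Matrix.sum_apply, Fin.sum_univ_two,
    ← Finset.sum_add_distrib]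
  congr 1
  refine Finset.sum_congr rfl fun i _ => ?_
  simp [Matrix.trace, Matrix.mul_apply, Matrix.single_apply]
  ring

theorem entFid_eq_of_apply_eq_depolActionC {N : KrausFamily (Fin 2) (Fin 2)} {p : ℂ}
    (h : ∀ ρ, N.apply ρ = depolActionC p ρ) : entFid N = 1 - p := by
  simp only [entFid_eq_sum_apply_single, h, Fin.sum_univ_two]
  simp [depolActionC, PauliX, PauliY, PauliZ, Matrix.vecMul, dotProduct, Matrix.mul_apply,
    Matrix.single_apply]
  ring

end EntanglementFidelity

section Twirl

variable {N : KrausFamily (Fin 2) (Fin 2)} {c : Fin 24 → Matrix (Fin 2) (Fin 2) ℂ}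

theorem ofReal_sqrt_inv_mul_self {x : ℝ} (hx : 0 ≤ x) :
    ((Real.sqrt x : ℝ) : ℂ)⁻¹ * ((Real.sqrt x : ℝ) : ℂ)⁻¹ = (x : ℂ)⁻¹ := by
  rw [← mul_inv, ← Complex.ofReal_mul, Real.mul_self_sqrt hx]

theorem twirl_apply (N : KrausFamily (Fin 2) (Fin 2)) (c : Fin 24 → Matrix (Fin 2) (Fin 2) ℂ)
    (ρ : Matrix (Fin 2) (Fin 2) ℂ) :
    (twirl N c).apply ρ =
      (24⁻¹ : ℂ) • ∑ i, (c i)ᴴ * N.apply (c i * ρ * (c i)ᴴ) * c i := by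
  have h24 := ofReal_sqrt_inv_mul_self (x := 24) (by norm_num)
  simp only [KrausFamily.apply, Finset.mul_sum, Finset.sum_mul, Finset.smul_sum]
  refine (Fintype.sum_prod_type _).trans ?_
  refine Finset.sum_congr rfl fun i _ => Finset.sum_congr rfl fun k _ => ?_
  simp only [twirl, Matrix.conjTranspose_smul, Matrix.conjTranspose_mul,
    Matrix.conjTranspose_conjTranspose, smul_mul_assoc, mul_smul_comm, smul_smul, star_inv₀,
    RCLike.star_def, Complex.conj_ofReal, h24, Matrix.mul_assoc]
  norm_num

theorem isChannel_twirl (hN : N.IsChannel) (hc : ∀ i, c i ∈ Matrix.unitaryGroup (Fin 2) ℂ) :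
    (twirl N c).IsChannel := by
  have h24 := ofReal_sqrt_inv_mul_self (x := 24) (by norm_num)
  refine (Fintype.sum_prod_type _).trans ?_
  have h (i : Fin 24) : ∑ k, ((twirl N c).K (i, k))ᴴ * (twirl N c).K (i, k) =
      (24⁻¹ : ℂ) • (1 : Matrix (Fin 2) (Fin 2) ℂ) := by
    have h₁ : c i * (c i)ᴴ = 1 := Matrix.mem_unitaryGroup_iff.1 (hc i)
    have h₂ : (c i)ᴴ * c i = 1 := Matrix.mem_unitaryGroup_iff'.1 (hc i)
    calc
      _ = ∑ k, (24⁻¹ : ℂ) • ((c i)ᴴ * ((N.K k)ᴴ * N.K k) * c i) := by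
        refine Finset.sum_congr rfl fun k _ => ?_
        simp only [twirl, Matrix.conjTranspose_smul, Matrix.conjTranspose_mul,
          Matrix.conjTranspose_conjTranspose, smul_mul_assoc, mul_smul_comm, smul_smul, star_inv₀,
          RCLike.star_def, Complex.conj_ofReal, h24, Matrix.mul_assoc]
        rw [← Matrix.mul_assoc (c i) (c i)ᴴ, h₁, one_mul]
        norm_num
      _ = (24⁻¹ : ℂ) • ((c i)ᴴ * (∑ k, (N.K k)ᴴ * N.K k) * c i) := by
        simp only [Finset.mul_sum, Finset.sum_mul, Finset.smul_sum]
      _ = _ := by rw [hN, mul_one, h₂]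
  refine (Finset.sum_congr rfl fun i _ => h i).trans ?_
  simp [← Nat.cast_smul_eq_nsmul ℂ]

theorem entFid_twirl (hc : ∀ i, c i ∈ Matrix.unitaryGroup (Fin 2) ℂ) :
    entFid (twirl N c) = entFid N := by
  have h24 := ofReal_sqrt_inv_mul_self (x := 24) (by norm_num)
  rw [entFid_eq_sum_trace, entFid_eq_sum_trace]
  congr 1
  refine (Fintype.sum_prod_type _).trans ?_
  have h (i : Fin 24) (k : N.ι) :
      ((twirl N c).K (i, k)).trace * star ((twirl N c).K (i, k)).trace =
        24⁻¹ * ((N.K k).trace * star (N.K k).trace) := by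
    have h₁ : c i * (c i)ᴴ = 1 := Matrix.mem_unitaryGroup_iff.1 (hc i)
    have ht : ((c i)ᴴ * N.K k * c i).trace = (N.K k).trace := by
      rw [Matrix.trace_mul_comm, ← Matrix.mul_assoc, h₁, one_mul]
    simp only [twirl, Matrix.trace_smul, ht, smul_eq_mul, star_mul', star_inv₀, RCLike.star_def,
      Complex.conj_ofReal]
    rw [mul_mul_mul_comm, h24]
    norm_num
  simp only [h, ← Finset.mul_sum]
  simp

end Twirl

section CliffordFamily

variable {N : KrausFamily (Fin 2) (Fin 2)} {c : Fin 24 → Matrix (Fin 2) (Fin 2) ℂ}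

theorem Had_mem_unitaryGroup : Had ∈ Matrix.unitaryGroup (Fin 2) ℂ := by
  have h2 := ofReal_sqrt_inv_mul_self (x := 2) zero_le_two
  rw [Matrix.mem_unitaryGroup_iff]
  ext i j
  fin_cases i <;> fin_cases j <;>
    simp [Had, Matrix.mul_apply, Matrix.star_apply, h2] <;> norm_num

theorem Sgate_mem_unitaryGroup : Sgate ∈ Matrix.unitaryGroup (Fin 2) ℂ := by
  rw [Matrix.mem_unitaryGroup_iff]
  ext i j
  fin_cases i <;> fin_cases j <;> simp [Sgate, Matrix.mul_apply, Matrix.star_apply]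

theorem closure_Had_Sgate_le_unitaryGroup :
    Submonoid.closure {Had, Sgate} ≤ Matrix.unitaryGroup (Fin 2) ℂ := by
  rw [Submonoid.closure_le]
  rintro _ (rfl | rfl)
  exacts [Had_mem_unitaryGroup, Sgate_mem_unitaryGroup]

theorem star_mul_self_eq_one_of_smul_mem_unitaryGroup {n : Type*} [Fintype n] [DecidableEq n]
    [Nonempty n] {u : Matrix n n ℂ} {z : ℂ} (hu : u ∈ Matrix.unitaryGroup n ℂ)
    (hzu : z • u ∈ Matrix.unitaryGroup n ℂ) : star z * z = 1 := by
  rw [Matrix.mem_unitaryGroup_iff'] at hu hzu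
  rw [star_smul, smul_mul_smul_comm, hu] at hzu
  obtain ⟨a⟩ := ‹Nonempty n›
  simpa using congrFun (congrFun hzu a) a

/-- Right multiplication by a generator permutes a Clifford family up to phases. -/
theorem IsCliffordFamily.exists_perm_mul_right (hc : IsCliffordFamily c)
    {g : Matrix (Fin 2) (Fin 2) ℂ} (hg : g ∈ Submonoid.closure {Had, Sgate}) :
    ∃ σ : Equiv.Perm (Fin 24), ∀ i, ∃ z : ℂ, star z * z = 1 ∧ c i * g = z • c (σ i) := by
  obtain ⟨hcU, hcG, hcE⟩ := hc
  have hgU := closure_Had_Sgate_le_unitaryGroup hg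
  have ne_zero {z : ℂ} (hz : star z * z = 1) : z ≠ 0 := right_ne_zero_of_mul_eq_one hz
  have exists_image (i : Fin 24) : ∃ j, ∃ z : ℂ, star z * z = 1 ∧ c i * g = z • c j := by
    obtain ⟨w, hw⟩ := hcG i
    have hw0 : w ≠ 0 := ne_zero <|
      star_mul_self_eq_one_of_smul_mem_unitaryGroup (hcU i) (closure_Had_Sgate_le_unitaryGroup hw)
    obtain ⟨j, ⟨v, hv⟩, -⟩ := hcE _ (mul_mem hw hg)
    have hj : c i * g = (w⁻¹ * v) • c j := by
      rw [mul_smul, ← hv, smul_mul_assoc, inv_smul_smul₀ hw0]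
    exact ⟨j, w⁻¹ * v,
      star_mul_self_eq_one_of_smul_mem_unitaryGroup (hcU j) (hj ▸ mul_mem (hcU i) hgU), hj⟩
  choose σ z hz hσ using exists_image
  have hinj : Function.Injective σ := by
    intro i j hij
    have hji : c j = (z j * (z i)⁻¹) • c i := by
      have h : c j * g = ((z j * (z i)⁻¹) • c i) * g := by
        rw [smul_mul_assoc, hσ, hσ, hij, smul_smul, inv_mul_cancel_right₀ (ne_zero (hz i))]
      simpa [Matrix.mul_assoc, Matrix.mem_unitaryGroup_iff.1 hgU] using congrArg (· * star g) h
    obtain ⟨w, hw⟩ := hcG j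
    exact (hcE _ hw).unique ⟨w * (z j * (z i)⁻¹), by rw [mul_smul, ← hji]⟩ ⟨w, rfl⟩
  exact ⟨Equiv.ofBijective σ (Finite.injective_iff_bijective.1 hinj), fun i => ⟨z i, hz i, hσ i⟩⟩

theorem IsCliffordFamily.twirl_apply_conj (hc : IsCliffordFamily c)
    {g : Matrix (Fin 2) (Fin 2) ℂ} (hg : g ∈ Submonoid.closure {Had, Sgate})
    (ρ : Matrix (Fin 2) (Fin 2) ℂ) :
    (twirl N c).apply (g * ρ * gᴴ) = g * (twirl N c).apply ρ * gᴴ := by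
  have hgU : g * gᴴ = 1 :=
    Matrix.mem_unitaryGroup_iff.1 (closure_Had_Sgate_le_unitaryGroup hg)
  obtain ⟨σ, hσ⟩ := hc.exists_perm_mul_right hg
  have key (i : Fin 24) :
      (c i)ᴴ * N.apply (c i * (g * ρ * gᴴ) * (c i)ᴴ) * c i =
        g * ((c (σ i))ᴴ * N.apply (c (σ i) * ρ * (c (σ i))ᴴ) * c (σ i)) * gᴴ := by
    obtain ⟨z, hz, h⟩ := hσ i
    have hz' : z * star z = 1 := by rw [mul_comm, hz]
    have hci : c i = z • (c (σ i) * gᴴ) := by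
      rw [← smul_mul_assoc, ← h, Matrix.mul_assoc, hgU, mul_one]
    have hin : c i * (g * ρ * gᴴ) * (c i)ᴴ = c (σ i) * ρ * (c (σ i))ᴴ := by
      calc
        _ = (c i * g) * ρ * (c i * g)ᴴ := by
          simp only [Matrix.conjTranspose_mul, Matrix.mul_assoc]
        _ = _ := by
          rw [h, Matrix.conjTranspose_smul, smul_mul_assoc, smul_mul_smul_comm, hz', one_smul]
    rw [hin, hci, Matrix.conjTranspose_smul, smul_mul_assoc, smul_mul_smul_comm, hz, one_smul,
      Matrix.conjTranspose_mul, Matrix.conjTranspose_conjTranspose]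
    simp only [Matrix.mul_assoc]
  simp only [twirl_apply, key, mul_smul_comm, smul_mul_assoc, ← Finset.mul_sum, ← Finset.sum_mul]
  rw [Equiv.sum_comp σ fun i => (c i)ᴴ * N.apply (c i * ρ * (c i)ᴴ) * c i]

end CliffordFamily

section Covariance

theorem Had_mul_PauliZ_mul : Had * PauliZ * Hadᴴ = PauliX := by
  have h2 := ofReal_sqrt_inv_mul_self (x := 2) zero_le_two
  ext i j
  fin_cases i <;> fin_cases j <;>
    simp [Had, PauliX, PauliZ, Matrix.mul_apply, h2] <;> norm_num

theorem Sgate_mul_PauliX_mul : Sgate * PauliX * Sgateᴴ = PauliY := by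
  ext i j
  fin_cases i <;> fin_cases j <;> simp [Sgate, PauliX, PauliY, Matrix.mul_apply]

theorem Sgate_mul_PauliZ_mul : Sgate * PauliZ * Sgateᴴ = PauliZ := by
  ext i j
  fin_cases i <;> fin_cases j <;> simp [Sgate, PauliZ, Matrix.mul_apply]

theorem eq_pauli_combination (ρ : Matrix (Fin 2) (Fin 2) ℂ) :
    ρ = ((ρ 0 0 + ρ 1 1) / 2) • (1 : Matrix (Fin 2) (Fin 2) ℂ) +
      ((ρ 0 1 + ρ 1 0) / 2) • PauliX + (Complex.I * (ρ 0 1 - ρ 1 0) / 2) • PauliY +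
      ((ρ 0 0 - ρ 1 1) / 2) • PauliZ := by
  ext i j
  fin_cases i <;> fin_cases j <;> simp [PauliX, PauliY, PauliZ] <;>
    ring_nf <;> simp only [Complex.I_sq] <;> ring

theorem off_diagonal_eq_zero_of_Sgate_conj {M : Matrix (Fin 2) (Fin 2) ℂ}
    (h : Sgate * M * Sgateᴴ = M) : M 0 1 = 0 ∧ M 1 0 = 0 := by
  have h01 := congrFun (congrFun h 0) 1
  have h10 := congrFun (congrFun h 1) 0
  simp [Sgate, Matrix.vecMul, dotProduct, Matrix.mul_apply] at h01 h10
  constructor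
  · linear_combination (-(1 - Complex.I) / 2) * h01 + (M 0 1 / 2) * Complex.I_sq
  · linear_combination (-(1 + Complex.I) / 2) * h10 + (M 1 0 / 2) * Complex.I_sq

/-- A trace-preserving linear map on qubit matrices that commutes with conjugation by
`H` and by `S` is a depolarizing map. -/
theorem exists_eq_depolActionC_of_covariant
    {T : Matrix (Fin 2) (Fin 2) ℂ →ₗ[ℂ] Matrix (Fin 2) (Fin 2) ℂ}
    (htr : ∀ ρ, (T ρ).trace = ρ.trace)
    (hH : ∀ ρ, T (Had * ρ * Hadᴴ) = Had * T ρ * Hadᴴ)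
    (hS : ∀ ρ, T (Sgate * ρ * Sgateᴴ) = Sgate * T ρ * Sgateᴴ) :
    ∃ p : ℂ, ∀ ρ, T ρ = depolActionC p ρ := by
  have h2 := ofReal_sqrt_inv_mul_self (x := 2) zero_le_two
  rw [Complex.ofReal_ofNat] at h2
  have hHU : Had * Hadᴴ = 1 := Matrix.mem_unitaryGroup_iff.1 Had_mem_unitaryGroup
  have hSU : Sgate * Sgateᴴ = 1 := Matrix.mem_unitaryGroup_iff.1 Sgate_mem_unitaryGroup
  have hZ : T PauliZ = (T PauliZ 0 0) • PauliZ := by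
    obtain ⟨h01, h10⟩ := off_diagonal_eq_zero_of_Sgate_conj
      (by rw [← hS, Sgate_mul_PauliZ_mul] : Sgate * T PauliZ * Sgateᴴ = T PauliZ)
    have ht := htr PauliZ
    simp [Matrix.trace, PauliZ] at ht
    ext i j
    fin_cases i <;> fin_cases j <;> simp [PauliZ]
    · exact h01
    · exact h10
    · linear_combination ht
  generalize T PauliZ 0 0 = a at hZ
  have hX : T PauliX = a • PauliX := by
    rw [← Had_mul_PauliZ_mul, hH, hZ, mul_smul_comm, smul_mul_assoc]
  have hY : T PauliY = a • PauliY := by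
    rw [← Sgate_mul_PauliX_mul, hS, hX, mul_smul_comm, smul_mul_assoc]
  have h1 : T 1 = 1 := by
    obtain ⟨h01, h10⟩ := off_diagonal_eq_zero_of_Sgate_conj
      (by rw [← hS, mul_one, hSU] : Sgate * T 1 * Sgateᴴ = T 1)
    have hHT : Had * T 1 * Hadᴴ = T 1 := by rw [← hH, mul_one, hHU]
    have hoff := congrFun (congrFun hHT 0) 1
    have ht := htr 1
    simp [Matrix.trace] at ht
    rw [h01] at hoff
    simp [Had, Matrix.vecMul, dotProduct, Matrix.mul_apply, h01, h10] at hoff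
    have hd : T 1 0 0 = T 1 1 1 := by
      linear_combination 2 * hoff - 2 * (T 1 0 0 - T 1 1 1) * h2
    ext i j
    fin_cases i <;> fin_cases j <;> simp
    · linear_combination ht / 2 + hd / 2
    · exact h01
    · exact h10
    · linear_combination ht / 2 - hd / 2
  refine ⟨3 / 4 * (1 - a), fun ρ => ?_⟩
  conv_lhs => rw [eq_pauli_combination ρ]
  simp only [map_add, map_smul, h1, hX, hY, hZ]
  ext i j
  fin_cases i <;> fin_cases j <;>
    simp [depolActionC, PauliX, PauliY, PauliZ, Matrix.vecMul, dotProduct, Matrix.mul_apply] <;>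
    ring_nf <;> try (simp only [Complex.I_sq]; ring)

end Covariance

/-- For any qubit channel `N`, the Clifford-twirled channel
`Ñ(ρ) = (1/|C|) Σ_{c ∈ C} c† N(c ρ c†) c` is the depolarizing channel `N_p` with
`p = 1 − ⟨φ⁺|(I⊗N)(|φ⁺⟩⟨φ⁺|)|φ⁺⟩`, and it has the same entanglement fidelity as `N`. -/
theorem twirl_eq_depolarizing_same_fidelity
    (N : KrausFamily (Fin 2) (Fin 2)) (hN : N.IsChannel)
    (c : Fin 24 → Matrix (Fin 2) (Fin 2) ℂ) (hc : IsCliffordFamily c) :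
    (∀ ρ : Matrix (Fin 2) (Fin 2) ℂ,
      (twirl N c).apply ρ = depolActionC (1 - entFid N) ρ) ∧
    entFid (twirl N c) = entFid N := by
  have hfid : entFid (twirl N c) = entFid N := entFid_twirl hc.1
  refine ⟨?_, hfid⟩
  obtain ⟨p, hp⟩ := exists_eq_depolActionC_of_covariant
    (T := (twirl N c).isLinearMap_apply.mk') (isChannel_twirl hN hc.1).trace_apply
    (hc.twirl_apply_conj (Submonoid.subset_closure (by simp)))
    (hc.twirl_apply_conj (Submonoid.subset_closure (by simp)))
  have hp' : ∀ ρ, (twirl N c).apply ρ = depolActionC p ρ := hp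
  rwa [← hfid, entFid_eq_of_apply_eq_depolActionC hp', sub_sub_cancel]
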